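/- For every positive integer l, setting r₁ = 2^(2l+1) − 2, r₂ = 2^(2l+1) − 1, and m = 2^(2l+2) − 2, there exist two sets C, D ⊆ ℕ with C ∪ D = ℕ and C ∩ D = (r₁ + mℕ) ∪ (r₂ + mℕ) such that R_C(n) = R_D(n) for all n ∈ ℕ. -/

import Mathlib

/-- `R S n` is the number of pairs `(s, s')` with `s, s' ∈ S`, `s < s'` and `s + s' = n`. -/
noncomputable def R (S : Set ℕ) (n : ℕ) : ℕ :=
  Set.ncard {p : ℕ × ℕ | p.1 ∈ S ∧ p.2 ∈ S ∧ p.1 < p.2 ∧ p.1 + p.2 = n}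

/-- `AP r m` is the arithmetic progression `r + mℕ = {r + m*k : k ∈ ℕ}`. -/
def AP (r m : ℕ) : Set ℕ := {n | ∃ k : ℕ, n = r + m * k}

open PowerSeries in
/-- A sequence that splits along the quotient and the remainder modulo `m` has a generating
function that factors. -/
theorem mk_div_mul_mod (m : ℕ) (hm : m ≠ 0) (u p : ℕ → ℤ) :
    (mk fun n => u (n / m) * p (n % m) : ℤ⟦X⟧) =
      (∑ j ∈ Finset.range m, C (p j) * X ^ j) * expand m hm (mk u) := by
  ext n
  rw [Finset.sum_mul, map_sum]
  simp only [mul_assoc, coeff_C_mul, coeff_X_pow_mul', coeff_expand, coeff_mk]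
  rw [Finset.sum_eq_single (n % m)]
  · rw [if_pos (Nat.mod_le n m), if_pos (Nat.dvd_sub_mod n), mul_comm]
    congr 2
    have h : n - n % m = m * (n / m) := by have := Nat.mod_add_div n m; omega
    rw [h, Nat.mul_div_cancel_left _ (Nat.pos_of_ne_zero hm)]
  · intro j hj hne
    split_ifs with h1 h2
    · have h3 : j % m = n % m := (Nat.modEq_iff_dvd' h1).2 h2
      exact absurd ((Nat.mod_eq_of_lt (Finset.mem_range.1 hj)).symm.trans h3) hne
    · simp
    · simp
  · intro h
    exact absurd (Finset.mem_range.2 (Nat.mod_lt n (Nat.pos_of_ne_zero hm))) h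

/-- The Thue–Morse sequence with values `1` and `-1`. -/
def thueMorse (n : ℕ) : ℤ := (-1) ^ (Nat.digits 2 n).sum

theorem thueMorse_zero : thueMorse 0 = 1 := by simp [thueMorse]

theorem thueMorse_two_mul (n : ℕ) : thueMorse (2 * n) = thueMorse n := by
  rcases Nat.eq_zero_or_pos n with rfl | hn
  · rfl
  · have h := Nat.digits_add 2 one_lt_two 0 n two_pos (Or.inr hn.ne')
    rw [zero_add] at h
    simp [thueMorse, h]

theorem thueMorse_two_mul_add_one (n : ℕ) : thueMorse (2 * n + 1) = -thueMorse n := by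
  have h := Nat.digits_add 2 one_lt_two 1 n one_lt_two (Or.inl one_ne_zero)
  rw [add_comm] at h
  rw [thueMorse, h, List.sum_cons, pow_add, pow_one, neg_one_mul, thueMorse]

theorem thueMorse_eq_one_or (n : ℕ) : thueMorse n = 1 ∨ thueMorse n = -1 :=
  neg_one_pow_eq_or ℤ _

theorem thueMorse_add_two_pow (k j : ℕ) (hj : j < 2 ^ k) :
    thueMorse (2 ^ k + j) = -thueMorse j := by
  induction k generalizing j with
  | zero =>
    obtain rfl : j = 0 := by simpa using hj
    exact thueMorse_two_mul_add_one 0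
  | succ k ih =>
    rw [pow_succ] at hj ⊢
    obtain ⟨i, rfl | rfl⟩ := Nat.even_or_odd' j
    · rw [show 2 ^ k * 2 + 2 * i = 2 * (2 ^ k + i) by ring, thueMorse_two_mul,
        thueMorse_two_mul, ih i (by omega)]
    · rw [show 2 ^ k * 2 + (2 * i + 1) = 2 * (2 ^ k + i) + 1 by ring, thueMorse_two_mul_add_one,
        thueMorse_two_mul_add_one, ih i (by omega)]

theorem thueMorse_two_pow_sub_one (k : ℕ) : thueMorse (2 ^ k - 1) = (-1) ^ k := by
  induction k with
  | zero => exact thueMorse_zero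
  | succ k ih =>
    have h : 2 ^ (k + 1) - 1 = 2 * (2 ^ k - 1) + 1 := by
      have := Nat.one_le_two_pow (n := k)
      rw [pow_succ]; omega
    rw [h, thueMorse_two_mul_add_one, ih, pow_succ, mul_neg_one]

open PowerSeries in
theorem mk_thueMorse :
    (mk thueMorse : ℤ⟦X⟧) = (1 - X) * expand 2 two_ne_zero (mk thueMorse) := by
  have h := mk_div_mul_mod 2 two_ne_zero thueMorse thueMorse
  rw [Finset.sum_range_succ, Finset.sum_range_one, thueMorse_zero,
    show thueMorse 1 = -1 from thueMorse_two_mul_add_one 0] at h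
  simp only [map_one, map_neg, pow_zero, pow_one, one_mul, neg_mul,
    ← sub_eq_add_neg] at h
  rw [← h]
  ext n
  rw [coeff_mk, coeff_mk]
  rcases Nat.even_or_odd' n with ⟨i, rfl | rfl⟩
  · simp [thueMorse_two_mul, thueMorse_zero]
  · rw [thueMorse_two_mul_add_one, show (2 * i + 1) / 2 = i by omega,
      show (2 * i + 1) % 2 = 1 by omega, show thueMorse 1 = -1 from thueMorse_two_mul_add_one 0,
      mul_neg_one]

open PowerSeries in
/-- The polynomial `∑ j < N, t j X ^ j`, where `t` is the Thue–Morse sequence. -/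
noncomputable def thueMorsePoly (N : ℕ) : ℤ⟦X⟧ :=
  ∑ j ∈ Finset.range N, C (thueMorse j) * X ^ j

open PowerSeries in
theorem thueMorsePoly_two_pow_succ (k : ℕ) :
    thueMorsePoly (2 ^ (k + 1)) = (1 - X ^ 2 ^ k) * thueMorsePoly (2 ^ k) := by
  rw [thueMorsePoly, pow_succ, mul_two, Finset.sum_range_add, sub_mul, one_mul, sub_eq_add_neg,
    thueMorsePoly, Finset.mul_sum, ← Finset.sum_neg_distrib]
  congr 1
  refine Finset.sum_congr rfl fun j hj => ?_
  rw [thueMorse_add_two_pow k j (Finset.mem_range.1 hj), map_neg]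
  ring

open PowerSeries in
theorem thueMorsePoly_two_mul (N : ℕ) :
    thueMorsePoly (2 * N) = (1 - X) * expand 2 two_ne_zero (thueMorsePoly N) := by
  induction N with
  | zero => simp [thueMorsePoly]
  | succ N ih =>
    rw [thueMorsePoly] at ih
    rw [thueMorsePoly, mul_add, mul_one, Finset.sum_range_succ, Finset.sum_range_succ, ih,
      thueMorsePoly, thueMorsePoly, Finset.sum_range_succ, map_add, map_mul, expand_C, map_pow,
      expand_X, thueMorse_two_mul, thueMorse_two_mul_add_one, map_neg]
    ring

open PowerSeries in
/-- Adding a multiple of a shift by `b` to a sequence of length `a` multiplies its generating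
polynomial by `1 + s X ^ b`. -/
theorem sum_range_add_shift (a b : ℕ) (s : ℤ) (u : ℕ → ℤ) :
    ∑ j ∈ Finset.range (b + a), (C ((if j < a then u j else 0) +
        s * (if b ≤ j then u (j - b) else 0)) * X ^ j : ℤ⟦X⟧) =
      (1 + C s * X ^ b) * ∑ j ∈ Finset.range a, C (u j) * X ^ j := by
  simp only [map_add, add_mul, Finset.sum_add_distrib, one_mul]
  congr 1
  · rw [add_comm b a, Finset.sum_range_add, add_eq_left.2]
    · exact Finset.sum_congr rfl fun j hj => by rw [if_pos (Finset.mem_range.1 hj)]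
    · exact Finset.sum_eq_zero fun j _ => by simp
  · rw [Finset.sum_range_add, add_eq_right.2, Finset.mul_sum]
    · refine Finset.sum_congr rfl fun j _ => ?_
      simp only [Nat.le_add_right, if_true, Nat.add_sub_cancel_left, map_mul]
      ring
    · exact Finset.sum_eq_zero fun j hj => by
        rw [if_neg (not_le.2 (Finset.mem_range.1 hj))]; simp

open PowerSeries Classical in
/-- The generating function of a set of natural numbers. -/
noncomputable def genFun (S : Set ℕ) : ℤ⟦X⟧ := mk fun n => if n ∈ S then 1 else 0

open Classical in
theorem R_eq_sum (S : Set ℕ) (n : ℕ) :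
    (R S n : ℤ) = ∑ p ∈ Finset.HasAntidiagonal.antidiagonal n,
      if p.1 < p.2 then (if p.1 ∈ S then 1 else 0) * (if p.2 ∈ S then 1 else 0) else 0 := by
  have h : {p : ℕ × ℕ | p.1 ∈ S ∧ p.2 ∈ S ∧ p.1 < p.2 ∧ p.1 + p.2 = n} =
      ((Finset.HasAntidiagonal.antidiagonal n).filter fun p =>
        p.1 < p.2 ∧ p.1 ∈ S ∧ p.2 ∈ S : Finset (ℕ × ℕ)) := by
    ext p
    simp only [Set.mem_ofPred_eq, Finset.coe_filter, Finset.HasAntidiagonal.mem_antidiagonal]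
    tauto
  rw [R, h, Set.ncard_coe_finset, Finset.card_filter, Nat.cast_sum]
  refine Finset.sum_congr rfl fun p _ => ?_
  by_cases h1 : p.1 < p.2 <;> by_cases h2 : p.1 ∈ S <;> by_cases h3 : p.2 ∈ S <;> simp [h1, h2, h3]

open PowerSeries Classical in
theorem coeff_genFun_sq (S : Set ℕ) (n : ℕ) :
    coeff n (genFun S ^ 2) = 2 * R S n + coeff n (expand 2 two_ne_zero (genFun S)) := by
  set c : ℕ → ℤ := fun n => if n ∈ S then 1 else 0 with hc
  have hlt : (R S n : ℤ) = ∑ p ∈ Finset.HasAntidiagonal.antidiagonal n,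
      if p.1 < p.2 then c p.1 * c p.2 else 0 := R_eq_sum S n
  have hgt : (R S n : ℤ) = ∑ p ∈ Finset.HasAntidiagonal.antidiagonal n,
      if p.2 < p.1 then c p.1 * c p.2 else 0 := by
    rw [hlt, ← Finset.Nat.sum_antidiagonal_swap]
    simp only [Prod.fst_swap, Prod.snd_swap, mul_comm]
  have heq : coeff n (expand 2 two_ne_zero (genFun S)) =
      ∑ p ∈ Finset.HasAntidiagonal.antidiagonal n,
      if p.1 = p.2 then c p.1 * c p.2 else 0 := by
    rw [coeff_expand, genFun, coeff_mk]
    split_ifs with h1 h2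
    · obtain ⟨k, rfl⟩ := h1
      rw [Nat.mul_div_cancel_left _ two_pos] at h2
      rw [Finset.sum_eq_single (k, k)]
      · simp [hc, h2]
      · rintro ⟨i, j⟩ hp hne
        rw [Finset.HasAntidiagonal.mem_antidiagonal] at hp
        exact if_neg fun h => hne (Prod.ext (by simp at *; omega) (by simp at *; omega))
      · intro h
        exact absurd (Finset.HasAntidiagonal.mem_antidiagonal.2 (two_mul k).symm) h
    · refine (Finset.sum_eq_zero fun p hp => ?_).symm
      rw [Finset.HasAntidiagonal.mem_antidiagonal] at hp
      refine ite_eq_right_iff.2 fun h => ?_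
      have : n / 2 = p.1 := by omega
      simp [hc, ← this, h2]
    · refine (Finset.sum_eq_zero fun p hp => if_neg fun h => h1 ⟨p.1, ?_⟩).symm
      rw [Finset.HasAntidiagonal.mem_antidiagonal] at hp
      omega
  rw [two_mul, heq]
  nth_rw 1 [hlt]
  rw [hgt, sq, coeff_mul, ← Finset.sum_add_distrib, ← Finset.sum_add_distrib]
  refine Finset.sum_congr rfl fun p _ => ?_
  rw [genFun, coeff_mk, coeff_mk]
  change c p.1 * c p.2 = _
  rcases lt_trichotomy p.1 p.2 with h | h | h
  · simp [h, h.ne, h.not_gt]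
  · simp [h]
  · simp [h, h.ne', h.not_gt]

open PowerSeries in
theorem R_eq_of_genFun {S T : Set ℕ}
    (h : (genFun S - genFun T) * (genFun S + genFun T) =
      expand 2 two_ne_zero (genFun S - genFun T)) (n : ℕ) : R S n = R T n := by
  have h1 := coeff_genFun_sq S n
  have h2 := coeff_genFun_sq T n
  have h3 : genFun S ^ 2 - genFun T ^ 2 =
      expand 2 two_ne_zero (genFun S) - expand 2 two_ne_zero (genFun T) := by
    rw [← map_sub, ← h]; ring
  have h4 := congrArg (coeff n) h3
  rw [map_sub, map_sub] at h4
  omega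

/-- The coefficients of `(1 - X ^ b) * ∑ j < b + 2, t j X ^ j` for the Thue–Morse sequence `t`. -/
def blockCoeff (b j : ℕ) : ℤ :=
  (if j < b + 2 then thueMorse j else 0) + -1 * (if b ≤ j then thueMorse (j - b) else 0)

/-- The difference of the indicator functions of the two sets. -/
def signSeq (b n : ℕ) : ℤ := thueMorse (n / (b + (b + 2))) * blockCoeff b (n % (b + (b + 2)))

theorem blockCoeff_cases {k b : ℕ} (hb : b + 2 = 2 ^ (2 * k + 1)) (hb0 : 0 < b) (j : ℕ) :
    (blockCoeff b j = 0 ∧ (j = b ∨ j = b + 1)) ∨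
      ((blockCoeff b j = 1 ∨ blockCoeff b j = -1) ∧ j ≠ b ∧ j ≠ b + 1) := by
  have hb1 : thueMorse (b + 1) = -1 := by
    have h := thueMorse_two_pow_sub_one (2 * k + 1)
    rw [← hb, pow_succ, pow_mul] at h
    simpa using h
  have hb2 : thueMorse b = 1 := by
    have h := thueMorse_two_pow_sub_one (2 * k)
    have h2 : b = 2 * (2 ^ (2 * k) - 1) := by rw [pow_succ] at hb; omega
    rw [← thueMorse_two_mul, ← h2, pow_mul] at h
    simpa using h
  have h1 : thueMorse 1 = -1 := thueMorse_two_mul_add_one 0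
  rcases lt_trichotomy j b with h | rfl | h
  · right
    refine ⟨?_, by omega, by omega⟩
    rw [blockCoeff, if_pos (by omega), if_neg (by omega)]
    simpa using thueMorse_eq_one_or j
  · left
    simp [blockCoeff, hb2, thueMorse_zero]
  · obtain rfl | h := Nat.eq_or_lt_of_le (Nat.succ_le_of_lt h)
    · left
      simp [blockCoeff, hb1, h1]
    · right
      refine ⟨?_, by omega, by omega⟩
      rw [blockCoeff, if_neg (by omega), if_pos (by omega)]
      rcases thueMorse_eq_one_or (j - b) with h | h <;> simp [h]

theorem signSeq_cases {k b : ℕ} (hb : b + 2 = 2 ^ (2 * k + 1)) (hb0 : 0 < b) (n : ℕ) :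
    (signSeq b n = 0 ∧ (n % (b + (b + 2)) = b ∨ n % (b + (b + 2)) = b + 1)) ∨
      ((signSeq b n = 1 ∨ signSeq b n = -1) ∧
        n % (b + (b + 2)) ≠ b ∧ n % (b + (b + 2)) ≠ b + 1) := by
  rcases blockCoeff_cases hb hb0 (n % (b + (b + 2))) with ⟨h, h'⟩ | ⟨h, h'⟩
  · exact Or.inl ⟨by simp [signSeq, h], h'⟩
  · refine Or.inr ⟨?_, h'⟩
    rcases thueMorse_eq_one_or (n / (b + (b + 2))) with h1 | h1 <;>
      rcases h with h | h <;> simp [signSeq, h, h1]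

open PowerSeries in
theorem mk_signSeq (b : ℕ) :
    (mk (signSeq b) : ℤ⟦X⟧) = (1 - X ^ b) * thueMorsePoly (b + 2) *
      expand (b + (b + 2)) (by omega) (mk thueMorse) := by
  have h := sum_range_add_shift (b + 2) b (-1) thueMorse
  rw [map_neg, map_one, neg_one_mul, ← sub_eq_add_neg] at h
  rw [thueMorsePoly, ← h]
  exact mk_div_mul_mod _ _ thueMorse (blockCoeff b)

open PowerSeries in
/-- The generating function of the sum of the indicator functions of the two sets. -/
theorem mk_multiplicity (b : ℕ) :
    (mk fun n => 1 + if n % (b + (b + 2)) = b ∨ n % (b + (b + 2)) = b + 1 then 1 else 0) *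
      ((1 - X) * (1 - X ^ (b + (b + 2)))) = ((1 + X ^ b) * (1 - X ^ (b + 2)) : ℤ⟦X⟧) := by
  have hm : b + (b + 2) ≠ 0 := by omega
  have h := mk_div_mul_mod (b + (b + 2)) hm 1 fun j =>
    (if j < b + 2 then 1 else 0) + 1 * (if b ≤ j then 1 else 0)
  rw [sum_range_add_shift (b + 2) b 1 fun _ => 1] at h
  have h1 : expand (b + (b + 2)) hm (mk 1 : ℤ⟦X⟧) * (1 - X ^ (b + (b + 2))) = 1 := by
    have := congrArg (expand (b + (b + 2)) hm) (mk_one_mul_one_sub_eq_one ℤ)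
    simpa using this
  have h2 : (∑ j ∈ Finset.range (b + 2), C 1 * X ^ j : ℤ⟦X⟧) * (1 - X) = 1 - X ^ (b + 2) := by
    simp only [map_one, one_mul]
    exact geom_sum_mul_neg X (b + 2)
  have h3 : (mk fun n => 1 + if n % (b + (b + 2)) = b ∨ n % (b + (b + 2)) = b + 1 then 1
      else 0 : ℤ⟦X⟧) = mk fun n => (1 : ℕ → ℤ) (n / (b + (b + 2))) *
        ((if n % (b + (b + 2)) < b + 2 then 1 else 0) +
          1 * (if b ≤ n % (b + (b + 2)) then 1 else 0)) := by
    ext n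
    rw [coeff_mk, coeff_mk, Pi.one_apply]
    split_ifs <;> first | rfl | omega
  rw [h3, h, map_one, one_mul]
  calc _ = (1 + X ^ b) * ((∑ j ∈ Finset.range (b + 2), C 1 * X ^ j : ℤ⟦X⟧) * (1 - X)) *
        (expand (b + (b + 2)) hm (mk 1) * (1 - X ^ (b + (b + 2)))) := by rw [map_one]; ring
    _ = _ := by rw [h1, h2, mul_one]

open PowerSeries in
theorem expand_mk_signSeq {k b : ℕ} (hb : b + 2 = 2 ^ k) :
    expand 2 two_ne_zero (mk (signSeq b) : ℤ⟦X⟧) * ((1 - X) * (1 - X ^ (b + (b + 2)))) =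
      mk (signSeq b) * ((1 + X ^ b) * (1 - X ^ (b + 2))) := by
  have hm : b + (b + 2) ≠ 0 := by omega
  have h1 : (1 - X) * expand 2 two_ne_zero (thueMorsePoly (b + 2)) =
      (1 - X ^ (b + 2)) * thueMorsePoly (b + 2) := by
    rw [← thueMorsePoly_two_mul, hb, ← thueMorsePoly_two_pow_succ, pow_succ, mul_comm]
  have h2 : expand (b + (b + 2)) hm (mk thueMorse : ℤ⟦X⟧) = (1 - X ^ (b + (b + 2))) *
      expand 2 two_ne_zero (expand (b + (b + 2)) hm (mk thueMorse)) := by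
    conv_lhs => rw [mk_thueMorse]
    rw [map_mul, map_sub, map_one, expand_X, ← expand_mul, ← expand_mul]
    simp only [mul_comm]
  have h3 : expand 2 two_ne_zero (1 - X ^ b : ℤ⟦X⟧) = (1 - X ^ b) * (1 + X ^ b) := by
    rw [map_sub, map_one, map_pow, expand_X]; ring
  rw [mk_signSeq, map_mul, map_mul, h3]
  calc _ = (1 - X ^ b) * (1 + X ^ b) * ((1 - X) * expand 2 two_ne_zero (thueMorsePoly (b + 2))) *
        ((1 - X ^ (b + (b + 2))) *
          expand 2 two_ne_zero (expand (b + (b + 2)) hm (mk thueMorse))) := by ring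
    _ = _ := by rw [h1, ← h2]; ring

open PowerSeries in
theorem one_sub_X_pow_ne_zero {n : ℕ} (hn : n ≠ 0) : (1 - X ^ n : ℤ⟦X⟧) ≠ 0 := by
  intro h
  have := congrArg (constantCoeff (R := ℤ)) h
  simp [hn] at this

theorem mem_AP_iff {r m n : ℕ} (h : r < m) : n ∈ AP r m ↔ n % m = r := by
  constructor
  · rintro ⟨k, rfl⟩
    rw [Nat.add_mul_mod_self_left, Nat.mod_eq_of_lt h]
  · rintro rfl
    exact ⟨n / m, (Nat.mod_add_div n m).symm⟩

open PowerSeries in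
theorem stmt_1 (l : ℕ) (hl : 0 < l) :
    ∃ C D : Set ℕ, C ∪ D = Set.univ ∧
      C ∩ D = AP (2 ^ (2 * l + 1) - 2) (2 ^ (2 * l + 2) - 2) ∪
        AP (2 ^ (2 * l + 1) - 1) (2 ^ (2 * l + 2) - 2) ∧
      ∀ n : ℕ, R C n = R D n := by
  obtain ⟨b, hb⟩ : ∃ b, b + 2 = 2 ^ (2 * l + 1) :=
    ⟨2 ^ (2 * l + 1) - 2, Nat.sub_add_cancel (Nat.le_self_pow (by omega) 2)⟩
  have hb0 : 0 < b := by
    have : 2 ^ 2 ≤ 2 ^ (2 * l + 1) := Nat.pow_le_pow_right two_pos (by omega)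
    omega
  have hcases := signSeq_cases hb hb0
  rw [show 2 ^ (2 * l + 2) - 2 = b + (b + 2) by rw [pow_succ, ← hb]; omega, ← hb,
    show b + 2 - 2 = b by omega, show b + 2 - 1 = b + 1 by omega]
  refine ⟨{n | 0 ≤ signSeq b n}, {n | signSeq b n ≤ 0}, ?_, ?_, ?_⟩
  · ext n
    simpa using le_total _ _
  · ext n
    rw [Set.mem_union, mem_AP_iff (by omega), mem_AP_iff (by omega), Set.mem_inter_iff,
      Set.mem_ofPred_eq, Set.mem_ofPred_eq]
    have := hcases n
    omega
  · refine R_eq_of_genFun ?_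
    have hsub : genFun {n | 0 ≤ signSeq b n} - genFun {n | signSeq b n ≤ 0} =
        mk (signSeq b) := by
      ext n
      simp only [genFun, map_sub, coeff_mk, Set.mem_ofPred_eq]
      have := hcases n
      split_ifs <;> omega
    have hadd : genFun {n | 0 ≤ signSeq b n} + genFun {n | signSeq b n ≤ 0} =
        mk fun n => 1 + if n % (b + (b + 2)) = b ∨ n % (b + (b + 2)) = b + 1 then 1 else 0 := by
      ext n
      simp only [genFun, map_add, coeff_mk, Set.mem_ofPred_eq]
      have := hcases n
      split_ifs <;> omega
    have hne : ((1 - X) * (1 - X ^ (b + (b + 2))) : ℤ⟦X⟧) ≠ 0 :=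
      mul_ne_zero (by simpa using one_sub_X_pow_ne_zero one_ne_zero)
        (one_sub_X_pow_ne_zero (by omega))
    refine mul_right_cancel₀ hne ?_
    rw [hsub, hadd, mul_assoc, mk_multiplicity, expand_mk_signSeq hb]
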